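/- For every real c < 5 there exists n₀ such that for all n ≥ n₀, every one-round 2-server private information retrieval scheme for n-bit databases with query size t, answer size ℓ, perfect recovery (ε = 1/2) and perfect privacy (η = 0) has total communication 2(t + ℓ) ≥ c · log₂ n. (In the paper's notation: every 2-server PIR scheme has C ≥ (5 − o(1)) log n.) -/

import Mathlib

/-- A one-round 2-server private information retrieval scheme for `n`-bit databases
with query size `t` and answer size `ℓ`: a finite probability space `Fin R` with
weights `pr` (the user's randomness), query functions `q1, q2`, the two servers'
answer functions `ans1, ans2`, and the user's output functions `out`. -/
structure PIRScheme (n t ℓ : ℕ) where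
  R : ℕ
  pr : Fin R → ℝ
  q1 : Fin n → Fin R → Fin t → Bool
  q2 : Fin n → Fin R → Fin t → Bool
  ans1 : (Fin n → Bool) → (Fin t → Bool) → Fin ℓ → Bool
  ans2 : (Fin n → Bool) → (Fin t → Bool) → Fin ℓ → Bool
  out : Fin n → Fin R → (Fin ℓ → Bool) → (Fin ℓ → Bool) → Bool

/-- The user's randomness is a probability distribution. -/
def PIRScheme.ProbDist {n t ℓ : ℕ} (P : PIRScheme n t ℓ) : Prop :=
  (∀ r, 0 ≤ P.pr r) ∧ ∑ r, P.pr r = 1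

/-- Recovery probability at least `1/2 + ε`: for every database `x` and index `i`, the
user outputs `x_i` with probability at least `1/2 + ε`. -/
def PIRScheme.Correct {n t ℓ : ℕ} (P : PIRScheme n t ℓ) (ε : ℝ) : Prop :=
  ∀ (x : Fin n → Bool) (i : Fin n),
    1 / 2 + ε ≤
      ∑ r ∈ Finset.univ.filter
        (fun r => P.out i r (P.ans1 x (P.q1 i r)) (P.ans2 x (P.q2 i r)) = x i),
        P.pr r

/-- `(1-η)`-security: for each server, the distributions of the query induced by any
two indices `i1, i2` are within total variation distance `η`. -/
def PIRScheme.Secure {n t ℓ : ℕ} (P : PIRScheme n t ℓ) (η : ℝ) : Prop :=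
  ∀ i1 i2 : Fin n,
    (1 / 2) * ∑ q : Fin t → Bool,
      |(∑ r ∈ Finset.univ.filter (fun r => P.q1 i1 r = q), P.pr r) -
        (∑ r ∈ Finset.univ.filter (fun r => P.q1 i2 r = q), P.pr r)| ≤ η ∧
    (1 / 2) * ∑ q : Fin t → Bool,
      |(∑ r ∈ Finset.univ.filter (fun r => P.q2 i1 r = q), P.pr r) -
        (∑ r ∈ Finset.univ.filter (fun r => P.q2 i2 r = q), P.pr r)| ≤ η

/-- The scheme uses only `b` (predetermined, depending on `i` and `r`) bits of each of
the two `ℓ`-bit answers. -/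
def PIRScheme.UsesBits {n t ℓ : ℕ} (P : PIRScheme n t ℓ) (b : ℕ) : Prop :=
  ∀ (i : Fin n) (r : Fin P.R),
    ∃ S0 S1 : Finset (Fin ℓ), S0.card = b ∧ S1.card = b ∧
      ∀ a0 a1 a0' a1' : Fin ℓ → Bool,
        (∀ k ∈ S0, a0 k = a0' k) → (∀ k ∈ S1, a1 k = a1' k) →
          P.out i r a0 a1 = P.out i r a0' a1'

open Finset in
/-- Greedy covering: if every `adj i` has `μ`-mass at least `δ`, some `m` points leave at most a
`(1 - δ) ^ m` fraction of the `i` uncovered. -/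
theorem exists_greedy_cover {I Q : Type*} [Fintype I] [Fintype Q]
    (μ : Q → ℝ) (hμ : ∀ q, 0 ≤ μ q) (hμ1 : ∑ q, μ q = 1)
    (adj : I → Q → Prop) [∀ i, DecidablePred (adj i)] (δ : ℝ) (hδ : δ ≤ 1)
    (h : ∀ i, δ ≤ ∑ q with adj i q, μ q) (m : ℕ) :
    ∃ b : Fin m → Q,
      (#{i | ∀ j, ¬ adj i (b j)} : ℝ) ≤ Fintype.card I * (1 - δ) ^ m := by
  induction m with
  | zero => exact ⟨Fin.elim0, by simp⟩
  | succ m ih =>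
    obtain ⟨b, hb⟩ := ih
    set U : Finset I := {i | ∀ j, ¬ adj i (b j)} with hU
    have havg : δ * #U ≤ ∑ q, μ q * #{i ∈ U | adj i q} := by
      calc δ * #U = ∑ i ∈ U, δ := by simp [mul_comm]
        _ ≤ ∑ i ∈ U, ∑ q with adj i q, μ q := sum_le_sum fun i _ => h i
        _ = ∑ q, μ q * #{i ∈ U | adj i q} := by
          simp_rw [sum_filter]
          rw [sum_comm]
          refine sum_congr rfl fun q _ => ?_
          rw [← sum_filter, sum_const, nsmul_eq_mul, mul_comm]
    obtain ⟨q, hq⟩ : ∃ q, δ * #U ≤ (#{i ∈ U | adj i q} : ℝ) := by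
      by_contra! hcon
      have hlt : ∑ q, μ q * (#{i ∈ U | adj i q} : ℝ) < ∑ q, μ q * (δ * #U) := by
        obtain ⟨q₀, -, hq₀⟩ : ∃ q ∈ univ, μ q ≠ 0 := by
          apply exists_ne_zero_of_sum_ne_zero
          rw [hμ1]; exact one_ne_zero
        refine sum_lt_sum (fun q _ => mul_le_mul_of_nonneg_left (hcon q).le (hμ q))
          ⟨q₀, mem_univ _, mul_lt_mul_of_pos_left (hcon q₀) ((hμ q₀).lt_of_ne' hq₀)⟩
      rw [← sum_mul, hμ1, one_mul] at hlt
      linarith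
    refine ⟨Fin.cons q b, ?_⟩
    have hset : ({i | ∀ j : Fin (m + 1), ¬ adj i ((Fin.cons q b : Fin (m + 1) → Q) j)} : Finset I)
        = {i ∈ U | ¬ adj i q} := by
      ext i
      simp [hU, Fin.forall_fin_succ, and_comm]
    rw [hset]
    have hsplit : (#{i ∈ U | adj i q} : ℝ) + #{i ∈ U | ¬ adj i q} = #U := by
      exact_mod_cast card_filter_add_card_filter_not (s := U) (fun i => adj i q)
    rw [pow_succ]
    nlinarith

open Finset in
/-- A map on databases that determines the coordinates in `T` takes at least `2 ^ #T` values. -/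
theorem card_le_of_determines {I Φ : Type*} [Fintype I] [Fintype Φ] (T : Finset I)
    (F : (I → Bool) → Φ) (h : ∀ x y, F x = F y → ∀ i ∈ T, x i = y i) :
    2 ^ #T ≤ Fintype.card Φ := by
  classical
  have hinj : Function.Injective
      (fun (x : T → Bool) => F fun i => if hi : i ∈ T then x ⟨i, hi⟩ else false) := by
    intro x y hxy
    funext ⟨i, hi⟩
    simpa [hi] using h _ _ hxy i hi
  simpa using Fintype.card_le_of_injective _ hinj

open Finset in
/-- Lower bound on the query size: the answers to `2 ^ (t - s)` queries to the first server and to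
`2 ^ s` queries to the second one determine at least half of the database. -/
theorem card_le_of_two_query_decoder {n t ℓ R : ℕ} {s : ℕ} (hs : s ≤ t)
    (p : Fin R → ℝ) (hp : ∀ r, 0 ≤ p r)
    (q1 q2 : Fin n → Fin R → Fin t → Bool)
    (ans1 ans2 : (Fin n → Bool) → (Fin t → Bool) → Fin ℓ → Bool)
    (out : Fin n → Fin R → (Fin ℓ → Bool) → (Fin ℓ → Bool) → Bool)
    (hdec : ∀ x i r, p r ≠ 0 → out i r (ans1 x (q1 i r)) (ans2 x (q2 i r)) = x i)
    (μ1 μ2 : (Fin t → Bool) → ℝ) (hμ1s : ∑ q, μ1 q = 1)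
    (hμ2 : ∀ q, 0 ≤ μ2 q) (hμ2s : ∑ q, μ2 q = 1)
    (h1 : ∀ i q, ∑ r with q1 i r = q, p r = μ1 q)
    (h2 : ∀ i q, ∑ r with q2 i r = q, p r = μ2 q) :
    n ≤ 2 * (ℓ * (2 ^ (t - s) + 2 ^ s)) := by
  classical
  have hcard : Fintype.card (Fin (2 ^ s) × Fin (2 ^ (t - s))) = Fintype.card (Fin t → Bool) := by
    simp [← pow_add, Nat.add_sub_cancel' hs]
  let e := Fintype.equivOfCardEq hcard
  have hδ : ((2 : ℝ) ^ s)⁻¹ ≤ 1 := inv_le_one_of_one_le₀ (one_le_pow₀ (by norm_num))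
  obtain ⟨a, ha⟩ : ∃ a, ((2 : ℝ) ^ s)⁻¹ ≤ ∑ b, μ1 (e (a, b)) := by
    have htot : ∑ a, ∑ b, μ1 (e (a, b)) = 1 := by
      rw [← Fintype.sum_prod_type', ← hμ1s]
      exact Equiv.sum_comp e μ1
    by_contra! hcon
    have : ∑ a, ∑ b, μ1 (e (a, b)) < ∑ a : Fin (2 ^ s), ((2 : ℝ) ^ s)⁻¹ :=
      sum_lt_sum_of_nonempty ⟨⟨0, by positivity⟩, mem_univ _⟩ fun a _ => hcon a
    rw [htot] at this
    simp at this
  let adj : Fin n → (Fin t → Bool) → Prop := fun i q =>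
    ∃ r, p r ≠ 0 ∧ q2 i r = q ∧ ∃ b, q1 i r = e (a, b)
  have hadj : ∀ i, ((2 : ℝ) ^ s)⁻¹ ≤ ∑ q with adj i q, μ2 q := by
    intro i
    refine ha.trans ?_
    have hl : ∑ b, μ1 (e (a, b)) = ∑ r, if ∃ b, q1 i r = e (a, b) then p r else 0 := by
      simp_rw [← h1 i, sum_filter]
      rw [sum_comm]
      refine sum_congr rfl fun r _ => ?_
      split_ifs with hb
      · obtain ⟨b, hb⟩ := hb
        simp [hb]
      · refine sum_eq_zero fun b _ => if_neg fun h => hb ⟨b, h⟩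
    have hr : ∑ q with adj i q, μ2 q = ∑ r, if adj i (q2 i r) then p r else 0 := by
      simp_rw [← h2 i, sum_filter]
      rw [← sum_filter, sum_comm]
      refine sum_congr rfl fun r _ => ?_
      simp [sum_ite_eq]
    rw [hl, hr]
    refine sum_le_sum fun r _ => ?_
    by_cases hb : ∃ b, q1 i r = e (a, b)
    · by_cases h0 : p r = 0
      · simp [h0]
      · rw [if_pos hb, if_pos ⟨r, h0, rfl, hb⟩]
    · rw [if_neg hb]
      split_ifs
      exacts [hp r, le_rfl]
  obtain ⟨c, hc⟩ := exists_greedy_cover μ2 hμ2 hμ2s adj _ hδ hadj (2 ^ s)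
  set U : Finset (Fin n) := {i | ∀ j, ¬ adj i (c j)} with hU
  have hhalf : (2 : ℝ) * #U ≤ n := by
    have he : (1 - ((2 : ℝ) ^ s)⁻¹) ^ (2 ^ s) ≤ 1 / 2 := by
      have := Real.one_sub_div_pow_le_exp_neg (n := 2 ^ s) (t := 1)
        (by exact_mod_cast Nat.one_le_two_pow)
      push_cast at this
      rw [one_div] at this
      refine this.trans ?_
      rw [Real.exp_neg, one_div]
      exact inv_anti₀ (by norm_num) (by linarith [Real.exp_one_gt_d9])
    rw [Fintype.card_fin] at hc
    nlinarith [(Nat.cast_nonneg n : (0 : ℝ) ≤ n)]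
  have hhalf' : 2 * #U ≤ n := by exact_mod_cast hhalf
  have hdet := card_le_of_determines Uᶜ
    (fun x => ((fun b => ans1 x (e (a, b)), fun j => ans2 x (c j)) :
      (Fin (2 ^ (t - s)) → Fin ℓ → Bool) × (Fin (2 ^ s) → Fin ℓ → Bool))) (by
    intro x y hxy i hi
    simp only [hU, mem_compl, mem_filter, mem_univ, true_and, not_forall, not_not] at hi
    obtain ⟨j, r, hr, hj, b, hb⟩ := hi
    rw [Prod.mk.injEq] at hxy
    rw [← hdec x i r hr, ← hdec y i r hr, hb, hj, congrFun hxy.1 b, congrFun hxy.2 j])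
  have hpow : Fintype.card ((Fin (2 ^ (t - s)) → Fin ℓ → Bool) × (Fin (2 ^ s) → Fin ℓ → Bool))
      = 2 ^ (ℓ * (2 ^ (t - s) + 2 ^ s)) := by
    simp [mul_add, pow_add, pow_mul]
  rw [hpow, Nat.pow_le_pow_iff_right (by norm_num), card_compl, Fintype.card_fin] at hdet
  omega

open Matrix

/-- The sign `±1` encoding a bit. -/
def bitSign (b : Bool) : ℝ := if b then 1 else -1

theorem abs_bitSign (b : Bool) : |bitSign b| = 1 := by cases b <;> simp [bitSign]

theorem bitSign_mul_self (b : Bool) : bitSign b * bitSign b = 1 := by cases b <;> simp [bitSign]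

open Finset in
theorem card_words_no_simple_le (n K : ℕ) :
    #{w : Fin (2 * K) → Fin n | ∀ i, #{j | w j = i} ≠ 1} ≤ n ^ K * K ^ (2 * K) := by
  have hcard : Fintype.card ((Fin K → Fin n) × (Fin (2 * K) → Fin K)) = n ^ K * K ^ (2 * K) := by
    simp
  rw [← hcard, ← card_univ]
  refine card_le_card_of_surjOn (fun gh => gh.1 ∘ gh.2) ?_
  intro w hw
  simp only [coe_filter, mem_univ, true_and, Set.mem_ofPred_eq] at hw
  have himg : #(univ.image w) ≤ K := by
    have h2 : 2 * #(univ.image w) ≤ #(univ : Finset (Fin (2 * K))) := by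
      refine mul_card_image_le_card (f := w) univ 2 fun i hi => ?_
      obtain ⟨j, -, rfl⟩ := mem_image.1 hi
      have hpos : 0 < #{j' | w j' = w j} := card_pos.2 ⟨j, by simp⟩
      have := hw (w j)
      omega
    simp at h2
    omega
  obtain ⟨φ⟩ : Nonempty ({i // i ∈ univ.image w} ↪ Fin K) :=
    Function.Embedding.nonempty_of_card_le (by rwa [Fintype.card_coe, Fintype.card_fin])
  rcases K.eq_zero_or_pos with rfl | hK
  · exact ⟨(Fin.elim0, Fin.elim0), by simp, funext fun j => absurd j.2 (by simp)⟩
  let f : Fin (2 * K) → {i // i ∈ univ.image w} := fun j => ⟨w j, mem_image_of_mem _ (mem_univ j)⟩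
  have : Nonempty {i // i ∈ univ.image w} := ⟨f ⟨0, by omega⟩⟩
  refine ⟨(fun k => (Function.invFun φ k).1, fun j => φ (f j)), by simp, ?_⟩
  funext j
  simp [Function.leftInverse_invFun φ.injective (f j), f]

open Finset in
theorem sum_prod_bitSign_eq_zero {n m : ℕ} {w : Fin m → Fin n} {i : Fin n}
    (hi : #{j | w j = i} = 1) :
    ∑ x : Fin n → Bool, ∏ j, bitSign (x (w j)) = 0 := by
  have hprod : ∀ x : Fin n → Bool,
      ∏ j, bitSign (x (w j)) = ∏ i, bitSign (x i) ^ #{j | w j = i} := by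
    intro x
    rw [← prod_fiberwise_of_maps_to (s := univ) (t := univ) (g := w) (fun _ _ => mem_univ _)]
    refine prod_congr rfl fun i _ => ?_
    rw [prod_congr rfl fun j hj => by rw [(mem_filter.1 hj).2], prod_const]
  simp_rw [hprod]
  rw [← Fintype.piFinset_univ, ← prod_univ_sum (fun _ : Fin n => (univ : Finset Bool))
    (fun i b => bitSign b ^ #{j | w j = i})]
  exact prod_eq_zero (mem_univ i) (by simp [hi, bitSign])

open Finset in
theorem abs_sum_prod_bitSign_le {n m : ℕ} (w : Fin m → Fin n) :
    |∑ x : Fin n → Bool, ∏ j, bitSign (x (w j))| ≤ 2 ^ n := by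
  refine (abs_sum_le_sum_abs _ _).trans ?_
  simp [abs_prod, abs_bitSign]

theorem sum_pow_eq_sum_words {A : Type*} [Semiring A] {n : ℕ} (a : Fin n → A) (m : ℕ) :
    (∑ i, a i) ^ m = ∑ w : Fin m → Fin n, (List.ofFn fun j => a (w j)).prod := by
  induction m with
  | zero => simp
  | succ m ih =>
    rw [pow_succ', ih, ← (Fin.consEquiv fun _ => Fin n).sum_comp, Fintype.sum_prod_type,
      Finset.sum_mul_sum]
    simp [Fin.consEquiv, List.ofFn_succ]

theorem prod_ofFn_smul {A : Type*} [Semiring A] [Algebra ℝ A] {m : ℕ}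
    (c : Fin m → ℝ) (a : Fin m → A) :
    (List.ofFn fun j => c j • a j).prod = (∏ j, c j) • (List.ofFn a).prod := by
  induction m with
  | zero => simp
  | succ m ih => simp [List.ofFn_succ, Fin.prod_univ_succ, ih, smul_smul, mul_comm]

section OpBound

variable {ι : Type*} [Fintype ι]

/-- The Euclidean operator norm of `M` is at most `B`. -/
def OpBound (M : Matrix ι ι ℝ) (B : ℝ) : Prop :=
  ∀ v : ι → ℝ, M *ᵥ v ⬝ᵥ M *ᵥ v ≤ B ^ 2 * (v ⬝ᵥ v)

theorem dotProduct_sq_le (u v : ι → ℝ) : (u ⬝ᵥ v) ^ 2 ≤ (u ⬝ᵥ u) * (v ⬝ᵥ v) := by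
  simpa [dotProduct, sq] using Finset.sum_mul_sq_le_sq_mul_sq Finset.univ u v

theorem opBound_of_bilinear {M : Matrix ι ι ℝ} {B : ℝ} (hB : 0 < B)
    (h : ∀ u v : ι → ℝ, u ⬝ᵥ M *ᵥ v ≤ B / 2 * (u ⬝ᵥ u + v ⬝ᵥ v)) : OpBound M B := by
  intro v
  have := h (B⁻¹ • (M *ᵥ v)) v
  simp only [smul_dotProduct, dotProduct_smul, smul_eq_mul] at this
  set a := M *ᵥ v ⬝ᵥ M *ᵥ v
  have h2 : B⁻¹ * a ≤ B / 2 * (B⁻¹ * (B⁻¹ * a)) + B / 2 * (v ⬝ᵥ v) := by linarith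
  have h3 : B / 2 * (B⁻¹ * (B⁻¹ * a)) = B⁻¹ * a / 2 := by field_simp
  rw [h3] at h2
  have h4 : B⁻¹ * a ≤ B * (v ⬝ᵥ v) := by linarith
  calc a = B * (B⁻¹ * a) := by field_simp
    _ ≤ B * (B * (v ⬝ᵥ v)) := by gcongr
    _ = _ := by ring

theorem OpBound.mul {M N : Matrix ι ι ℝ} {B C : ℝ} (hM : OpBound M B) (hN : OpBound N C) :
    OpBound (M * N) (B * C) := by
  intro v
  rw [← mulVec_mulVec]
  calc _ ≤ B ^ 2 * (N *ᵥ v ⬝ᵥ N *ᵥ v) := hM _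
    _ ≤ B ^ 2 * (C ^ 2 * (v ⬝ᵥ v)) := by gcongr; exact hN v
    _ = _ := by ring

theorem dotProduct_transpose_mul_mulVec_le_trace (T : Matrix ι ι ℝ) {v : ι → ℝ}
    (hv : v ⬝ᵥ v = 1) : v ⬝ᵥ (Tᵀ * T) *ᵥ v ≤ (Tᵀ * T).trace := by
  have h1 : v ⬝ᵥ (Tᵀ * T) *ᵥ v = T *ᵥ v ⬝ᵥ T *ᵥ v := by
    rw [← mulVec_mulVec, dotProduct_mulVec, vecMul_transpose]
  rw [h1, trace_mul_comm]
  refine Finset.sum_le_sum fun i _ => ?_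
  have := dotProduct_sq_le (T i) v
  rw [hv, mul_one, sq] at this
  exact this

variable [DecidableEq ι]

theorem OpBound.prod_ofFn {m : ℕ} {M : Fin m → Matrix ι ι ℝ} {B : ℝ}
    (h : ∀ j, OpBound (M j) B) : OpBound (List.ofFn M).prod (B ^ m) := by
  induction m with
  | zero => intro v; simp
  | succ m ih =>
    rw [List.ofFn_succ, List.prod_cons, pow_succ']
    exact (h 0).mul (ih fun j => h j.succ)

theorem OpBound.abs_trace_le {M : Matrix ι ι ℝ} {B : ℝ} (hB : 0 ≤ B) (h : OpBound M B) :
    |M.trace| ≤ Fintype.card ι * B := by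
  have hentry : ∀ i, |M i i| ≤ B := by
    intro i
    have := h (Pi.single i 1)
    simp only [mulVec_single_one, dotProduct_single, Pi.single_eq_same, mul_one] at this
    refine abs_le_of_sq_le_sq (le_trans ?_ this) hB
    rw [sq]
    exact Finset.single_le_sum (f := fun k => M.col i k * M.col i k)
      (fun k _ => mul_self_nonneg _) (Finset.mem_univ i)
  calc |M.trace| ≤ ∑ i, |M i i| := Finset.abs_sum_le_sum_abs _ _
    _ ≤ ∑ _i : ι, B := Finset.sum_le_sum fun i _ => hentry i
    _ = _ := by simp

theorem Matrix.IsSymm.pow_two_pow_le {S : Matrix ι ι ℝ} (hS : S.IsSymm) {v : ι → ℝ}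
    (hv : v ⬝ᵥ v = 1) {a : ℝ} (ha : 0 ≤ a) (h : a ≤ v ⬝ᵥ S *ᵥ v) (j : ℕ) :
    a ^ 2 ^ j ≤ v ⬝ᵥ (S ^ 2 ^ j) *ᵥ v := by
  induction j with
  | zero => simpa using h
  | succ j ih =>
    have hT : (S ^ 2 ^ j)ᵀ = S ^ 2 ^ j := by rw [transpose_pow, hS.eq]
    calc a ^ 2 ^ (j + 1) = (a ^ 2 ^ j) ^ 2 := by ring
      _ ≤ (v ⬝ᵥ (S ^ 2 ^ j) *ᵥ v) ^ 2 := by gcongr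
      _ ≤ (v ⬝ᵥ v) * ((S ^ 2 ^ j) *ᵥ v ⬝ᵥ (S ^ 2 ^ j) *ᵥ v) := dotProduct_sq_le _ _
      _ = v ⬝ᵥ (S ^ 2 ^ (j + 1)) *ᵥ v := by
        rw [hv, one_mul, pow_succ 2, pow_mul, sq, ← mulVec_mulVec, dotProduct_mulVec v,
          ← mulVec_transpose, hT]

theorem Matrix.IsSymm.pow_le_trace {S : Matrix ι ι ℝ} (hS : S.IsSymm) {v : ι → ℝ}
    (hv : v ⬝ᵥ v = 1) {a : ℝ} (ha : 0 ≤ a) (h : a ≤ v ⬝ᵥ S *ᵥ v) (j : ℕ) :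
    a ^ (2 * 2 ^ j) ≤ (S ^ (2 * 2 ^ j)).trace := by
  have hT : S ^ (2 * 2 ^ j) = (S ^ 2 ^ j)ᵀ * S ^ 2 ^ j := by
    rw [transpose_pow, hS.eq, ← pow_add, two_mul]
  refine le_trans ?_ (hT ▸ dotProduct_transpose_mul_mulVec_le_trace (S ^ 2 ^ j) hv)
  rw [← pow_succ']
  exact hS.pow_two_pow_le hv ha h (j + 1)

open Finset in
/-- Moment method: if every signed sum of the symmetric matrices `M i` of norm at most `B` has
norm at least `n`, then `n` is at most about `B ^ 2`, up to the dimension and moment factors. -/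
theorem pow_le_of_forall_signs {n : ℕ} (hn : 0 < n) {M : Fin n → Matrix ι ι ℝ} {B : ℝ} (hB : 0 ≤ B)
    (hsymm : ∀ i, (M i).IsSymm) (hbound : ∀ i, OpBound (M i) B)
    (h : ∀ x : Fin n → Bool, ∃ v : ι → ℝ, v ⬝ᵥ v = 1 ∧
      (n : ℝ) ≤ v ⬝ᵥ (∑ i, bitSign (x i) • M i) *ᵥ v) (j : ℕ) :
    (n : ℝ) ^ 2 ^ j ≤
      Fintype.card ι * B ^ (2 * 2 ^ j) * ((2 : ℝ) ^ j) ^ (2 * 2 ^ j) := by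
  set K := 2 ^ j with hK
  set W : Finset (Fin (2 * K) → Fin n) := {w | ∀ i, #{j | w j = i} ≠ 1} with hW
  have hlow : ∀ x : Fin n → Bool,
      (n : ℝ) ^ (2 * K) ≤ ((∑ i, bitSign (x i) • M i) ^ (2 * K)).trace := by
    intro x
    obtain ⟨v, hv, hle⟩ := h x
    refine Matrix.IsSymm.pow_le_trace ?_ hv (Nat.cast_nonneg n) hle j
    simp [Matrix.IsSymm, transpose_sum, (hsymm _).eq]
  have hmain : (2 : ℝ) ^ n * (n : ℝ) ^ (2 * K) ≤
      2 ^ n * (#W * (Fintype.card ι * B ^ (2 * K))) := by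
    calc (2 : ℝ) ^ n * (n : ℝ) ^ (2 * K)
        = ∑ _x : Fin n → Bool, (n : ℝ) ^ (2 * K) := by simp
      _ ≤ ∑ x : Fin n → Bool, ((∑ i, bitSign (x i) • M i) ^ (2 * K)).trace :=
        sum_le_sum fun x _ => hlow x
      _ = ∑ w : Fin (2 * K) → Fin n, (∑ x : Fin n → Bool, ∏ j, bitSign (x (w j))) *
          (List.ofFn fun j => M (w j)).prod.trace := by
        simp_rw [sum_pow_eq_sum_words, prod_ofFn_smul, trace_sum, trace_smul, smul_eq_mul]
        rw [sum_comm]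
        simp_rw [sum_mul]
      _ = ∑ w ∈ W, (∑ x : Fin n → Bool, ∏ j, bitSign (x (w j))) *
          (List.ofFn fun j => M (w j)).prod.trace := by
        refine (sum_subset (subset_univ W) fun w _ hw => ?_).symm
        simp only [hW, mem_filter, mem_univ, true_and, not_forall, not_not] at hw
        obtain ⟨i, hi⟩ := hw
        rw [sum_prod_bitSign_eq_zero hi, zero_mul]
      _ ≤ ∑ _w ∈ W, 2 ^ n * (Fintype.card ι * B ^ (2 * K)) := by
        refine sum_le_sum fun w _ => (le_abs_self _).trans ?_
        rw [abs_mul]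
        exact mul_le_mul (abs_sum_prod_bitSign_le w)
          ((OpBound.prod_ofFn fun j => hbound (w j)).abs_trace_le (by positivity))
          (abs_nonneg _) (by positivity)
      _ = _ := by rw [sum_const, nsmul_eq_mul]; ring
  have hWle : (#W : ℝ) ≤ (n : ℝ) ^ K * (K : ℝ) ^ (2 * K) := by
    exact_mod_cast card_words_no_simple_le n K
  have h1 := le_of_mul_le_mul_left hmain (by positivity)
  have h2 : (n : ℝ) ^ K * (n : ℝ) ^ K ≤
      (n : ℝ) ^ K * (Fintype.card ι * B ^ (2 * K) * (K : ℝ) ^ (2 * K)) := by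
    calc (n : ℝ) ^ K * (n : ℝ) ^ K = (n : ℝ) ^ (2 * K) := by ring
      _ ≤ _ := h1
      _ ≤ ((n : ℝ) ^ K * (K : ℝ) ^ (2 * K)) * (Fintype.card ι * B ^ (2 * K)) := by gcongr
      _ = _ := by ring
  have h3 := le_of_mul_le_mul_left h2 (by positivity)
  simpa [hK] using h3

end OpBound
section QueryMatrix

variable {Q A R : Type*} [Fintype Q] [Fintype A] [Fintype R] [DecidableEq Q]

/-- The joint distribution of the two queries `a r` and `b r`, normalised by its marginals `μ` and
`ν`, where the entry at `(a r, b r)` is replaced by the block `s r` indexed by pairs of answers. -/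
noncomputable def queryMatrix (p : R → ℝ) (a b : R → Q) (s : R → A → A → ℝ) (μ ν : Q → ℝ) :
    Matrix (Q × A) (Q × A) ℝ :=
  of fun u v => ∑ r, if a r = u.1 ∧ b r = v.1 then
    p r / (√(μ u.1) * √(ν v.1)) * s r u.2 v.2 else 0

variable {p : R → ℝ} {a b : R → Q} {s : R → A → A → ℝ} {μ ν : Q → ℝ}

theorem dotProduct_queryMatrix_mulVec (u v : Q × A → ℝ) :
    u ⬝ᵥ queryMatrix p a b s μ ν *ᵥ v =
      ∑ r, p r / (√(μ (a r)) * √(ν (b r))) *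
        ∑ α, ∑ β, u (a r, α) * s r α β * v (b r, β) := by
  simp only [dotProduct, mulVec, queryMatrix, of_apply, Finset.sum_mul, Finset.mul_sum]
  simp_rw [Finset.sum_comm (t := (Finset.univ : Finset R))]
  refine Finset.sum_congr rfl fun r _ => ?_
  simp_rw [Fintype.sum_prod_type]
  rw [Finset.sum_eq_single (a r) (by intro q _ hq; simp [hq.symm]) (by simp)]
  refine Finset.sum_congr rfl fun α _ => ?_
  rw [Finset.sum_eq_single (b r) (by intro q _ hq; simp [hq.symm]) (by simp)]
  refine Finset.sum_congr rfl fun β _ => ?_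
  simp
  ring

theorem sum_div_marginal_mul_sq_le (hμ : ∀ q, ∑ r with a r = q, p r = μ q)
    (u : Q × A → ℝ) :
    ∑ r, p r * ((∑ α, |u (a r, α)|) ^ 2 / μ (a r)) ≤ Fintype.card A * (u ⬝ᵥ u) := by
  calc ∑ r, p r * ((∑ α, |u (a r, α)|) ^ 2 / μ (a r))
      = ∑ q, ∑ r with a r = q, p r * ((∑ α, |u (a r, α)|) ^ 2 / μ (a r)) :=
        (Finset.sum_fiberwise _ _ _).symm
    _ = ∑ q, μ q * ((∑ α, |u (q, α)|) ^ 2 / μ q) := by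
        refine Finset.sum_congr rfl fun q _ => ?_
        rw [← hμ q, Finset.sum_mul]
        refine Finset.sum_congr rfl fun r hr => ?_
        rw [(Finset.mem_filter.1 hr).2, hμ q]
    _ ≤ ∑ q, Fintype.card A * ∑ α, u (q, α) * u (q, α) := by
        refine Finset.sum_le_sum fun q _ => ?_
        have hsq : (∑ α, |u (q, α)|) ^ 2 ≤ Fintype.card A * ∑ α, u (q, α) * u (q, α) := by
          simpa [sq] using sq_sum_le_card_mul_sum_sq (s := Finset.univ) (f := fun α => |u (q, α)|)
        refine le_trans ?_ hsq
        rcases eq_or_ne (μ q) 0 with h0 | h0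
        · rw [h0, zero_mul]; positivity
        · rw [mul_div_cancel₀ _ h0]
    _ = Fintype.card A * (u ⬝ᵥ u) := by
        rw [← Finset.mul_sum, dotProduct, Fintype.sum_prod_type]

theorem dotProduct_queryMatrix_mulVec_le (hp : ∀ r, 0 ≤ p r)
    (hμ : ∀ q, ∑ r with a r = q, p r = μ q) (hν : ∀ q, ∑ r with b r = q, p r = ν q)
    (hs : ∀ r α β, |s r α β| ≤ 1) (u v : Q × A → ℝ) :
    u ⬝ᵥ queryMatrix p a b s μ ν *ᵥ v ≤ Fintype.card A / 2 * (u ⬝ᵥ u + v ⬝ᵥ v) := by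
  have hμ0 : ∀ q, 0 ≤ μ q := fun q => hμ q ▸ Finset.sum_nonneg fun r _ => hp r
  have hν0 : ∀ q, 0 ≤ ν q := fun q => hν q ▸ Finset.sum_nonneg fun r _ => hp r
  rw [dotProduct_queryMatrix_mulVec]
  have hterm : ∀ r, p r / (√(μ (a r)) * √(ν (b r))) *
        ∑ α, ∑ β, u (a r, α) * s r α β * v (b r, β) ≤
      (p r * ((∑ α, |u (a r, α)|) ^ 2 / μ (a r)) +
        p r * ((∑ β, |v (b r, β)|) ^ 2 / ν (b r))) / 2 := by
    intro r
    have hin : ∑ α, ∑ β, u (a r, α) * s r α β * v (b r, β) ≤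
        (∑ α, |u (a r, α)|) * ∑ β, |v (b r, β)| := by
      rw [Finset.sum_mul_sum]
      refine Finset.sum_le_sum fun α _ => Finset.sum_le_sum fun β _ => ?_
      refine (le_abs_self _).trans ?_
      rw [abs_mul, abs_mul]
      refine mul_le_mul_of_nonneg_right ?_ (abs_nonneg _)
      exact mul_le_of_le_one_right (abs_nonneg _) (hs r α β)
    set U := ∑ α, |u (a r, α)|
    set V := ∑ β, |v (b r, β)|
    have hU : U ^ 2 / μ (a r) = (U / √(μ (a r))) ^ 2 := by
      rw [div_pow, Real.sq_sqrt (hμ0 _)]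
    have hV : V ^ 2 / ν (b r) = (V / √(ν (b r))) ^ 2 := by
      rw [div_pow, Real.sq_sqrt (hν0 _)]
    calc _ ≤ p r / (√(μ (a r)) * √(ν (b r))) * (U * V) :=
          mul_le_mul_of_nonneg_left hin (div_nonneg (hp r) (by positivity))
      _ = p r * ((U / √(μ (a r))) * (V / √(ν (b r)))) := by rw [div_mul_div_comm]; ring
      _ ≤ p r * (((U / √(μ (a r))) ^ 2 + (V / √(ν (b r))) ^ 2) / 2) :=
          mul_le_mul_of_nonneg_left
            (by linarith [two_mul_le_add_sq (U / √(μ (a r))) (V / √(ν (b r)))]) (hp r)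
      _ = _ := by rw [hU, hV]; ring
  refine (Finset.sum_le_sum fun r _ => hterm r).trans ?_
  rw [← Finset.sum_div, Finset.sum_add_distrib]
  linarith [sum_div_marginal_mul_sq_le hμ u, sum_div_marginal_mul_sq_le hν v]

/-- The symmetric dilation of a square matrix. -/
def dilation {κ : Type*} (G : Matrix κ κ ℝ) : Matrix (κ ⊕ κ) (κ ⊕ κ) ℝ := fromBlocks 0 G Gᵀ 0

theorem isSymm_dilation {κ : Type*} (G : Matrix κ κ ℝ) : (dilation G).IsSymm := by
  simp [dilation, Matrix.IsSymm, fromBlocks_transpose]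

theorem dotProduct_dilation_mulVec {κ : Type*} [Fintype κ] (G : Matrix κ κ ℝ)
    (y z : κ ⊕ κ → ℝ) :
    y ⬝ᵥ dilation G *ᵥ z = (y ∘ Sum.inl) ⬝ᵥ G *ᵥ (z ∘ Sum.inr) +
      (z ∘ Sum.inl) ⬝ᵥ G *ᵥ (y ∘ Sum.inr) := by
  rw [dilation, fromBlocks_mulVec, ← Sum.elim_comp_inl_inr y, sumElim_dotProduct_sumElim]
  simp only [Sum.elim_comp_inl_inr, zero_mulVec, zero_add, add_zero]
  rw [mulVec_transpose, dotProduct_comm (y ∘ Sum.inr), ← dotProduct_mulVec]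

theorem opBound_dilation {κ : Type*} [Fintype κ] {G : Matrix κ κ ℝ} {B : ℝ} (hB : 0 < B)
    (h : ∀ u v : κ → ℝ, u ⬝ᵥ G *ᵥ v ≤ B / 2 * (u ⬝ᵥ u + v ⬝ᵥ v)) : OpBound (dilation G) B := by
  refine opBound_of_bilinear hB fun y z => ?_
  have hsplit : ∀ y : κ ⊕ κ → ℝ,
      y ⬝ᵥ y = (y ∘ Sum.inl) ⬝ᵥ (y ∘ Sum.inl) + (y ∘ Sum.inr) ⬝ᵥ (y ∘ Sum.inr) := by
    intro y
    simp [dotProduct]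
  rw [dotProduct_dilation_mulVec, hsplit y, hsplit z]
  linarith [h (y ∘ Sum.inl) (z ∘ Sum.inr), h (z ∘ Sum.inl) (y ∘ Sum.inr)]

end QueryMatrix

/-- The vector recording the answers `f q` to the queries `q`, weighted by `√(μ q)`. -/
noncomputable def answerVec {Q A : Type*} [DecidableEq A] (μ : Q → ℝ) (f : Q → A) : Q × A → ℝ :=
  fun u => if f u.1 = u.2 then √(μ u.1) else 0

theorem answerVec_dotProduct_self {Q A : Type*} [Fintype Q] [Fintype A] [DecidableEq A]
    {μ : Q → ℝ} (hμ : ∀ q, 0 ≤ μ q) (f : Q → A) :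
    answerVec μ f ⬝ᵥ answerVec μ f = ∑ q, μ q := by
  simp only [dotProduct, answerVec, Fintype.sum_prod_type]
  refine Finset.sum_congr rfl fun q _ => ?_
  simp [hμ q]

theorem answerVec_dotProduct_queryMatrix {Q A R : Type*} [Fintype Q] [Fintype A] [Fintype R]
    [DecidableEq Q] [DecidableEq A] {p : R → ℝ} {a b : R → Q} {s : R → A → A → ℝ} {μ ν : Q → ℝ}
    (hp : ∀ r, 0 ≤ p r)
    (hμ : ∀ q, ∑ r with a r = q, p r = μ q) (hν : ∀ q, ∑ r with b r = q, p r = ν q)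
    (f g : Q → A) :
    answerVec μ f ⬝ᵥ queryMatrix p a b s μ ν *ᵥ answerVec ν g =
      ∑ r, p r * s r (f (a r)) (g (b r)) := by
  rw [dotProduct_queryMatrix_mulVec]
  refine Finset.sum_congr rfl fun r _ => ?_
  rcases (hp r).eq_or_lt with h0 | h0
  · simp [← h0]
  have hμr : 0 < μ (a r) := h0.trans_le <| hμ (a r) ▸
    Finset.single_le_sum (fun r _ => hp r) (by simp)
  have hνr : 0 < ν (b r) := h0.trans_le <| hν (b r) ▸
    Finset.single_le_sum (fun r _ => hp r) (by simp)
  have h1 := (Real.sqrt_pos.2 hμr).ne'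
  have h2 := (Real.sqrt_pos.2 hνr).ne'
  simp only [answerVec, ite_mul, mul_ite, zero_mul, mul_zero, Finset.sum_ite_eq, Finset.mem_univ,
    if_true]
  field_simp

/-- Lower bound on the answer size: `n` is at most about the square of the number of answers. -/
theorem pow_le_of_two_query_decoder {n R : ℕ} {Q A : Type*} [Fintype Q] [Fintype A]
    [DecidableEq Q] [DecidableEq A] [Nonempty A] (hn : 0 < n)
    {p : Fin R → ℝ} (hp : ∀ r, 0 ≤ p r) (hp1 : ∑ r, p r = 1)
    (q1 q2 : Fin n → Fin R → Q) (ans1 ans2 : (Fin n → Bool) → Q → A)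
    (out : Fin n → Fin R → A → A → Bool)
    (hdec : ∀ x i r, p r ≠ 0 → out i r (ans1 x (q1 i r)) (ans2 x (q2 i r)) = x i)
    {μ ν : Q → ℝ} (hμs : ∑ q, μ q = 1) (hνs : ∑ q, ν q = 1)
    (hμ : ∀ i q, ∑ r with q1 i r = q, p r = μ q)
    (hν : ∀ i q, ∑ r with q2 i r = q, p r = ν q) (j : ℕ) :
    (n : ℝ) ^ 2 ^ j ≤ (2 * (Fintype.card Q * Fintype.card A) : ℕ) *
      (Fintype.card A : ℝ) ^ (2 * 2 ^ j) * ((2 : ℝ) ^ j) ^ (2 * 2 ^ j) := by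
  have hμ0 : ∀ q, 0 ≤ μ q := fun q => hμ ⟨0, hn⟩ q ▸ Finset.sum_nonneg fun r _ => hp r
  have hν0 : ∀ q, 0 ≤ ν q := fun q => hν ⟨0, hn⟩ q ▸ Finset.sum_nonneg fun r _ => hp r
  let M : Fin n → Matrix (Q × A ⊕ Q × A) (Q × A ⊕ Q × A) ℝ := fun i => dilation
    (queryMatrix p (q1 i) (q2 i) (fun r α β => bitSign (out i r α β)) μ ν)
  have key := pow_le_of_forall_signs (M := M) (B := Fintype.card A) hn (by positivity)
    (fun i => isSymm_dilation _)
    (fun i => opBound_dilation (by exact_mod_cast Fintype.card_pos) fun u v =>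
      dotProduct_queryMatrix_mulVec_le hp (hμ i) (hν i) (fun r α β => (abs_bitSign _).le) u v)
    (fun x => ?_) j
  · simpa [two_mul] using key
  set z : Q × A ⊕ Q × A → ℝ := Sum.elim (answerVec μ (ans1 x)) (answerVec ν (ans2 x)) with hz
  have hzz : z ⬝ᵥ z = 2 := by
    rw [hz, sumElim_dotProduct_sumElim, answerVec_dotProduct_self hμ0,
      answerVec_dotProduct_self hν0, hμs, hνs]
    norm_num
  have hzM : ∀ i, z ⬝ᵥ M i *ᵥ z = 2 * bitSign (x i) := by
    intro i
    rw [dotProduct_dilation_mulVec, hz, Sum.elim_comp_inl, Sum.elim_comp_inr,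
      answerVec_dotProduct_queryMatrix hp (hμ i) (hν i), ← two_mul]
    congr 1
    rw [← one_mul (bitSign (x i)), ← hp1, Finset.sum_mul]
    refine Finset.sum_congr rfl fun r _ => ?_
    rcases eq_or_ne (p r) 0 with h0 | h0
    · simp [h0]
    · rw [hdec x i r h0]
  refine ⟨(√2)⁻¹ • z, ?_, ?_⟩
  · rw [smul_dotProduct, dotProduct_smul, hzz, smul_smul, ← mul_inv,
      Real.mul_self_sqrt zero_le_two]
    norm_num
  · rw [mulVec_smul, smul_dotProduct, dotProduct_smul, smul_smul, ← mul_inv,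
      Real.mul_self_sqrt zero_le_two, sum_mulVec, dotProduct_sum]
    simp only [smul_mulVec, dotProduct_smul, hzM, smul_eq_mul]
    rw [Finset.mul_sum]
    refine le_of_eq ?_
    have : ∀ i, (2 : ℝ)⁻¹ * (bitSign (x i) * (2 * bitSign (x i))) = 1 := by
      intro i
      linarith [bitSign_mul_self (x i)]
    simp [this]

open Filter in
theorem eventually_rate_bounds {δ : ℝ} (hδ : 0 < δ) (C : ℝ) :
    ∀ᶠ n : ℕ in atTop, 0 < n ∧ C ≤ δ * Real.logb 2 n ∧
      Real.logb 2 (5 / 2 * Real.logb 2 n) ≤ δ * Real.logb 2 n := by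
  have hL : Tendsto (fun n : ℕ => Real.logb 2 n) atTop atTop :=
    (Real.tendsto_logb_atTop one_lt_two).comp tendsto_natCast_atTop_atTop
  have hlog2 : 0 < Real.log 2 := Real.log_pos one_lt_two
  have hε : 0 < δ * Real.log 2 * (2 / 5) := by positivity
  filter_upwards [eventually_gt_atTop 0, (hL.const_mul_atTop hδ).eventually_ge_atTop C,
    hL.eventually_gt_atTop 0,
    (hL.const_mul_atTop (by norm_num : (0 : ℝ) < 5 / 2)).eventually
      (Real.isLittleO_log_id_atTop.bound hε)] with n hn hC hpos hlog
  refine ⟨hn, hC, ?_⟩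
  rw [Real.norm_eq_abs, id, Real.norm_of_nonneg (by positivity)] at hlog
  rw [Real.logb, div_le_iff₀ hlog2]
  calc _ ≤ _ := (le_abs_self _).trans hlog
    _ = _ := by ring

theorem logb_le_of_query_bound {n t ℓ : ℕ} (hn : 0 < n)
    (h : n ≤ 2 * (ℓ * (2 ^ (t - (t + 1) / 2) + 2 ^ ((t + 1) / 2)))) :
    0 < ℓ ∧ Real.logb 2 n ≤ 2 + Real.logb 2 ℓ + (t + 1) / 2 := by
  have hℓ : 0 < ℓ := by
    rcases ℓ.eq_zero_or_pos with rfl | h0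
    · simp at h; omega
    · exact h0
  refine ⟨hℓ, ?_⟩
  have hle : n ≤ 2 ^ 2 * ℓ * 2 ^ ((t + 1) / 2) := by
    have : 2 ^ (t - (t + 1) / 2) ≤ 2 ^ ((t + 1) / 2) :=
      Nat.pow_le_pow_right (by norm_num) (by omega)
    calc n ≤ _ := h
      _ ≤ 2 * (ℓ * (2 ^ ((t + 1) / 2) + 2 ^ ((t + 1) / 2))) := by gcongr
      _ = _ := by ring
  have hle' : (n : ℝ) ≤ 2 ^ 2 * ℓ * 2 ^ ((t + 1) / 2) := by exact_mod_cast hle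
  have hlog := Real.logb_le_logb_of_le one_lt_two (by positivity) hle'
  rw [Real.logb_mul (by positivity) (by positivity), Real.logb_mul (by positivity) (by positivity),
    Real.logb_pow, Real.logb_pow, Real.logb_self_eq_one one_lt_two] at hlog
  have hdiv : (((t + 1) / 2 : ℕ) : ℝ) ≤ ((t + 1 : ℕ) : ℝ) / 2 := Nat.cast_div_le
  push_cast at hlog hdiv
  linarith

theorem logb_le_of_answer_bound {n t ℓ j : ℕ} (hn : 0 < n)
    (h : (n : ℝ) ^ 2 ^ j ≤ (2 * (2 ^ t * 2 ^ ℓ)) * ((2 : ℝ) ^ ℓ) ^ (2 * 2 ^ j) *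
      ((2 : ℝ) ^ j) ^ (2 * 2 ^ j)) :
    2 ^ j * Real.logb 2 n ≤ 1 + t + ℓ + 2 * 2 ^ j * (ℓ + j) := by
  have hrhs : (2 * (2 ^ t * 2 ^ ℓ)) * ((2 : ℝ) ^ ℓ) ^ (2 * 2 ^ j) * ((2 : ℝ) ^ j) ^ (2 * 2 ^ j) =
      2 ^ (1 + t + ℓ + 2 * 2 ^ j * (ℓ + j)) := by ring
  rw [hrhs] at h
  have hlog := Real.logb_le_logb_of_le one_lt_two (by positivity) h
  rw [Real.logb_pow, Real.logb_pow, Real.logb_self_eq_one one_lt_two] at hlog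
  push_cast at hlog
  linarith

theorem PIRScheme.Secure.marginals {n t ℓ : ℕ} {P : PIRScheme n t ℓ} (h : P.Secure 0)
    (i i' : Fin n) (q : Fin t → Bool) :
    ∑ r with P.q1 i r = q, P.pr r = ∑ r with P.q1 i' r = q, P.pr r ∧
      ∑ r with P.q2 i r = q, P.pr r = ∑ r with P.q2 i' r = q, P.pr r := by
  have hzero : ∀ f : (Fin t → Bool) → ℝ, (1 / 2) * ∑ q, |f q| ≤ 0 → f q = 0 := by
    intro f hf
    have := Finset.single_le_sum (f := fun q => |f q|) (fun q _ => abs_nonneg _) (Finset.mem_univ q)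
    exact abs_nonpos_iff.1 (by linarith)
  exact ⟨sub_eq_zero.1 (hzero _ (h i i').1), sub_eq_zero.1 (hzero _ (h i i').2)⟩

theorem PIRScheme.Correct.out_eq {n t ℓ : ℕ} {P : PIRScheme n t ℓ} (h : P.Correct (1 / 2))
    (hP : P.ProbDist) (x : Fin n → Bool) (i : Fin n) (r : Fin P.R) (hr : P.pr r ≠ 0) :
    P.out i r (P.ans1 x (P.q1 i r)) (P.ans2 x (P.q2 i r)) = x i := by
  by_contra hne
  have hsplit := Finset.sum_filter_add_sum_filter_not Finset.univ
    (fun r => P.out i r (P.ans1 x (P.q1 i r)) (P.ans2 x (P.q2 i r)) = x i) P.pr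
  rw [hP.2] at hsplit
  have hle : P.pr r ≤ ∑ r with ¬ P.out i r (P.ans1 x (P.q1 i r)) (P.ans2 x (P.q2 i r)) = x i,
      P.pr r := Finset.single_le_sum (fun r _ => hP.1 r) (by simpa using hne)
  have := h x i
  exact hr (le_antisymm (by linarith) (hP.1 r))

theorem sum_marginal_eq_one {n t R : ℕ} {p : Fin R → ℝ} (hp : ∑ r, p r = 1)
    (q : Fin n → Fin R → Fin t → Bool) (i : Fin n) : ∑ k, ∑ r with q i r = k, p r = 1 := by
  rw [← hp]
  exact Finset.sum_fiberwise _ _ _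

/-- every one-round 2-server PIR scheme with perfect recovery and perfect
privacy has total communication `C = 2(t+ℓ) ≥ (5 - o(1)) log₂ n`; formally, for every
`c < 5` there is an `n₀` such that for all `n ≥ n₀` every such scheme satisfies
`2(t+ℓ) ≥ c log₂ n`. -/
theorem stmt18 (c : ℝ) (hc : c < 5) :
    ∃ n₀ : ℕ, ∀ n : ℕ, n₀ ≤ n →
      ∀ (t ℓ : ℕ) (P : PIRScheme n t ℓ),
        P.ProbDist → P.Correct (1 / 2) → P.Secure 0 →
        c * Real.logb 2 n ≤ 2 * (t + ℓ) := by
  obtain ⟨j, hj⟩ := pow_unbounded_of_one_lt (10 / (5 - c)) one_lt_two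
  have hδ : 0 < (5 - c) / 16 := by linarith
  obtain ⟨n₀, hn₀⟩ := Filter.eventually_atTop.1 (eventually_rate_bounds hδ (6 + j))
  refine ⟨n₀, fun n hn t ℓ P hP hcor hsec => ?_⟩
  obtain ⟨hnpos, hC, hlog⟩ := hn₀ n hn
  by_contra! hlt
  have hdec := hcor.out_eq hP
  have h1 := fun i q => (hsec.marginals i ⟨0, hnpos⟩ q).1
  have h2 := fun i q => (hsec.marginals i ⟨0, hnpos⟩ q).2
  have hs1 := sum_marginal_eq_one hP.2 P.q1 ⟨0, hnpos⟩
  have hs2 := sum_marginal_eq_one hP.2 P.q2 ⟨0, hnpos⟩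
  obtain ⟨hℓ, hquery⟩ := logb_le_of_query_bound hnpos <|
    card_le_of_two_query_decoder (s := (t + 1) / 2) (by omega) P.pr hP.1 P.q1 P.q2
      P.ans1 P.ans2 P.out hdec _ _ hs1 (fun q => Finset.sum_nonneg fun r _ => hP.1 r) hs2 h1 h2
  have hanswer := logb_le_of_answer_bound (n := n) (t := t) (ℓ := ℓ) (j := j) hnpos (by
    simpa using pow_le_of_two_query_decoder hnpos hP.1 hP.2 P.q1 P.q2 P.ans1 P.ans2 P.out
      hdec hs1 hs2 h1 h2 j)
  set L := Real.logb 2 n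
  have hL : 0 < L := by
    have : 0 < (5 - c) / 16 * L := lt_of_lt_of_le (by positivity) hC
    exact pos_of_mul_pos_right this hδ.le
  have hsum : (t : ℝ) + ℓ ≤ 5 / 2 * L := by nlinarith
  have hlogℓ : Real.logb 2 ℓ ≤ (5 - c) / 16 * L :=
    (Real.logb_le_logb_of_le one_lt_two (by exact_mod_cast hℓ)
      (by linarith [(Nat.cast_nonneg t : (0 : ℝ) ≤ t)])).trans hlog
  set K : ℝ := 2 ^ j
  have hK1 : 1 ≤ K := one_le_pow₀ one_le_two
  have hK : 10 < K * (5 - c) := (div_lt_iff₀ (by linarith)).1 hj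
  have hℓlow : L ≤ 1 + (5 - c) / 4 * L + 2 * (ℓ + j) := by
    refine le_of_mul_le_mul_left ?_ (zero_lt_one.trans_le hK1)
    nlinarith [mul_lt_mul_of_pos_right hK hL]
  linarith
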